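/- Assume W is a double-well potential (W ∈ C¹(ℝ), W(-1) = W(1) = 0, W(s) > 0 for s ≠ ±1). Then the one-dimensional functional J₁ attains its infimum over X₁: there exists u ∈ X₁ with J₁(u) = inf_{v ∈ X₁} J₁(v). -/

import Mathlib

open MeasureTheory Filter Topology Set
open scoped ENNReal

noncomputable section

/-- The class `X₁`: `W^{1,∞}(ℝ)` functions with `‖u'‖_{L^∞} ≤ 1` and `u(t) → ±1` as
`t → ±∞`. -/
def memX1 (u : ℝ → ℝ) : Prop :=
  LipschitzWith 1 u ∧ Tendsto u atTop (𝓝 (1:ℝ)) ∧ Tendsto u atBot (𝓝 (-1:ℝ))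

/-- `W` is a double-well potential: `C¹`, vanishing exactly at `±1` and positive elsewhere. -/
def DoubleWell (W : ℝ → ℝ) : Prop :=
  ContDiff ℝ 1 W ∧ W (-1) = 0 ∧ W 1 = 0 ∧ ∀ s : ℝ, s ≠ -1 → s ≠ 1 → 0 < W s

/-- The action functional `L_a(u) = ∫_ℝ (1 - √(1 - |u'|²) + a(t) W(u)) dt`. -/
def LaE (a W u : ℝ → ℝ) : ℝ≥0∞ :=
  ∫⁻ t : ℝ, ENNReal.ofReal (1 - Real.sqrt (1 - (deriv u t) ^ 2) + a t * W (u t))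

/-- `u` is a `C¹ ∩ W^{2,2}_loc` solution of `(u'/√(1-|u'|²))' = a(t) W'(u)` on `ℝ`,
expressed through the integrated form of the equation. -/
def SolvesEL (a W u : ℝ → ℝ) : Prop :=
  ContDiff ℝ 1 u ∧
  ∀ s t : ℝ,
    deriv u t / Real.sqrt (1 - (deriv u t) ^ 2)
      - deriv u s / Real.sqrt (1 - (deriv u s) ^ 2)
    = ∫ r in s..t, a r * deriv W (u r)

/-- The one-dimensional free-energy functional `J₁`. -/
def J1 (W u : ℝ → ℝ) : ℝ≥0∞ :=
  ∫⁻ t : ℝ, ENNReal.ofReal (1 - Real.sqrt (1 - (deriv u t) ^ 2) + W (u t))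

/-- A `1`-Lipschitz front joining `-1` to `1` along the flow of a speed `g ≤ 1` which is positive
on `(-1, 1)` and vanishes at `±1`, obtained by separation of variables. -/
theorem exists_front {g : ℝ → ℝ} (hg : Continuous g) (hpos : ∀ s ∈ Ioo (-1 : ℝ) 1, 0 < g s)
    (hle : ∀ s, g s ≤ 1) (hneg : g (-1) = 0) (hone : g 1 = 0) :
    ∃ u : ℝ → ℝ, memX1 u ∧ (∀ t, u t ∈ Icc (-1 : ℝ) 1) ∧ ∀ t, deriv u t = g (u t) := by
  set T : ℝ → ℝ := fun s => ∫ r in (0 : ℝ)..s, (g r)⁻¹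
  have hcont : ContinuousOn (fun r => (g r)⁻¹) (Ioo (-1 : ℝ) 1) :=
    hg.continuousOn.inv₀ fun s hs => (hpos s hs).ne'
  have hT : ∀ s ∈ Ioo (-1 : ℝ) 1, HasDerivAt T (g s)⁻¹ s := by
    intro s hs
    refine intervalIntegral.integral_hasDerivAt_right ?_ ?_ ?_
    · refine (hcont.mono ?_).intervalIntegrable
      exact (ordConnected_Ioo).uIcc_subset (by norm_num) hs
    · exact hcont.stronglyMeasurableAtFilter isOpen_Ioo s hs
    · exact hcont.continuousAt (isOpen_Ioo.mem_nhds hs)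
  have hTsub : ∀ s ∈ Ioo (-1 : ℝ) 1, ∀ s' ∈ Ioo (-1 : ℝ) 1, s ≤ s' → s' - s ≤ T s' - T s := by
    intro s hs s' hs' hss'
    have hmono : MonotoneOn (fun r => T r - r) (Ioo (-1 : ℝ) 1) := by
      refine monotoneOn_of_hasDerivWithinAt_nonneg (f' := fun r => (g r)⁻¹ - 1)
        (convex_Ioo _ _) ?_ ?_ ?_
      · exact fun r hr => ((hT r hr).continuousAt.sub continuousAt_id).continuousWithinAt
      · intro r hr
        rw [interior_Ioo] at hr
        exact ((hT r hr).sub (hasDerivAt_id r)).hasDerivWithinAt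
      · intro r hr
        rw [interior_Ioo] at hr
        exact sub_nonneg.2 ((one_le_inv₀ (hpos r hr)).2 (hle r))
    have := hmono hs hs' hss'
    simp only at this
    linarith
  set S : ℝ → Set ℝ := fun t => insert (-1) {s | s ∈ Ioo (-1 : ℝ) 1 ∧ T s ≤ t}
  have hSle : ∀ t, ∀ s ∈ S t, s ≤ 1 := by
    rintro t s (rfl | hs)
    · norm_num
    · exact hs.1.2.le
  have hbdd : ∀ t, BddAbove (S t) := fun t => ⟨1, hSle t⟩
  have hne : ∀ t, (S t).Nonempty := fun t => ⟨-1, mem_insert _ _⟩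
  set u : ℝ → ℝ := fun t => sSup (S t)
  have hu : ∀ t, u t ∈ Icc (-1 : ℝ) 1 := fun t =>
    ⟨le_csSup (hbdd t) (mem_insert _ _), csSup_le (hne t) (hSle t)⟩
  have hle_u : ∀ t, ∀ s ∈ Ioo (-1 : ℝ) 1, T s ≤ t → s ≤ u t := fun t s hs hst =>
    le_csSup (hbdd t) (mem_insert_of_mem _ ⟨hs, hst⟩)
  have hu_le : ∀ t, ∀ s ∈ Ioo (-1 : ℝ) 1, t < T s → u t ≤ s := by
    intro t s hs hst
    refine csSup_le (hne t) ?_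
    rintro r (rfl | ⟨hr, hrt⟩)
    · exact hs.1.le
    · by_contra! hsr
      linarith [hTsub s hs r hr hsr.le]
  have hu_mono : Monotone u := by
    intro t t' htt'
    by_contra! h
    obtain ⟨s, hs, hs'⟩ := exists_between h
    have hsI : s ∈ Ioo (-1 : ℝ) 1 := ⟨(hu t').1.trans_lt hs, hs'.trans_le (hu t).2⟩
    have h1 : T s ≤ t := by
      by_contra! h1
      linarith [hu_le t s hsI h1]
    linarith [hle_u t' s hsI (h1.trans htt')]
  have hu_lip : ∀ t t', t ≤ t' → u t' - u t ≤ t' - t := by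
    intro t t' htt'
    by_contra! h
    obtain ⟨δ, hδ, hδ'⟩ := exists_between (show t' - t < u t' - u t from h)
    set s := u t + (u t' - u t - δ) / 2 with hs
    have hsI : s ∈ Ioo (-1 : ℝ) 1 := ⟨by linarith [(hu t).1], by linarith [(hu t').2]⟩
    have hsI' : s + δ ∈ Ioo (-1 : ℝ) 1 := ⟨by linarith [(hu t).1], by linarith [(hu t').2]⟩
    have h1 : t < T s := by
      by_contra! h1
      linarith [hle_u t s hsI h1]
    have h2 : T (s + δ) ≤ t' := by
      by_contra! h2
      linarith [hu_le t' _ hsI' h2]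
    linarith [hTsub s hsI _ hsI' (by linarith)]
  have hLip : LipschitzWith 1 u := by
    refine LipschitzWith.of_le_add fun t t' => ?_
    rw [Real.dist_eq]
    rcases le_total t t' with h | h
    · linarith [hu_mono h, abs_nonneg (t - t')]
    · linarith [hu_lip t' t h, le_abs_self (t - t')]
  have hTu : ∀ t, u t ∈ Ioo (-1 : ℝ) 1 → T (u t) = t := by
    intro t ht
    have hcT : ContinuousAt T (u t) := (hT _ ht).continuousAt
    have hnhds : Ioo (-1 : ℝ) 1 ∈ 𝓝 (u t) := isOpen_Ioo.mem_nhds ht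
    refine le_antisymm ?_ ?_
    · refine le_of_tendsto (hcT.tendsto.mono_left nhdsWithin_le_nhds : Tendsto T (𝓝[<] (u t)) _) ?_
      filter_upwards [self_mem_nhdsWithin, nhdsWithin_le_nhds hnhds] with s hs hsI
      by_contra! h
      exact absurd (hu_le t s hsI h) (not_le.2 hs)
    · refine ge_of_tendsto (hcT.tendsto.mono_left nhdsWithin_le_nhds : Tendsto T (𝓝[>] (u t)) _) ?_
      filter_upwards [self_mem_nhdsWithin, nhdsWithin_le_nhds hnhds] with s hs hsI
      by_contra! h
      exact absurd (hle_u t s hsI h.le) (not_le.2 hs)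
  refine ⟨u, ⟨hLip, ?_, ?_⟩, hu, ?_⟩
  · refine tendsto_order.2 ⟨fun a ha => ?_, fun a ha => .of_forall fun t => (hu t).2.trans_lt ha⟩
    obtain ⟨s, hs, hs'⟩ := exists_between (max_lt ha (by norm_num : (-1 : ℝ) < 1))
    filter_upwards [eventually_ge_atTop (T s)] with t ht
    exact ((le_max_left _ _).trans_lt hs).trans_le
      (hle_u t s ⟨(le_max_right _ _).trans_lt hs, hs'⟩ ht)
  · refine tendsto_order.2 ⟨fun a ha => .of_forall fun t => ha.trans_le (hu t).1, fun a ha => ?_⟩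
    obtain ⟨s, hs, hs'⟩ := exists_between (lt_min ha (by norm_num : (-1 : ℝ) < 1))
    filter_upwards [eventually_lt_atBot (T s)] with t ht
    exact (hu_le t s ⟨hs, hs'.trans_le (min_le_right _ _)⟩ ht).trans_lt
      (hs'.trans_le (min_le_left _ _))
  · intro t
    rcases (hu t).1.eq_or_lt with h | h
    · have hmin : IsLocalMin u t := .of_forall fun r => h ▸ (hu r).1
      rw [hmin.deriv_eq_zero, ← h, hneg]
    rcases (hu t).2.eq_or_lt with h' | h'
    · have hmax : IsLocalMax u t := .of_forall fun r => h' ▸ (hu r).2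
      rw [hmax.deriv_eq_zero, h', hone]
    have hev : ∀ᶠ r in 𝓝 t, T (u r) = r :=
      (hLip.continuous.continuousAt.eventually (isOpen_Ioo.mem_nhds ⟨h, h'⟩)).mono hTu
    have := HasDerivAt.of_local_left_inverse hLip.continuous.continuousAt (hT _ ⟨h, h'⟩)
      (inv_ne_zero (hpos _ ⟨h, h'⟩).ne') hev
    rw [this.deriv, inv_inv]

/-- Chain rule along a Lipschitz curve, in integrated form. -/
theorem integral_comp_mul_deriv_of_lipschitz {F v : ℝ → ℝ} (hF : Continuous F) {K : NNReal}
    (hv : LipschitzWith K v) (a b : ℝ) :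
    ∫ t in a..b, F (v t) * deriv v t = ∫ s in v a..v b, F s := by
  set Φ : ℝ → ℝ := fun x => ∫ s in (0 : ℝ)..x, F s
  have hΦ : ∀ x, HasDerivAt Φ (F x) x := fun x => hF.integral_hasStrictDerivAt 0 x |>.hasDerivAt
  have hΦ1 : ContDiff ℝ 1 Φ := by
    rw [contDiff_one_iff_deriv]
    refine ⟨fun x => (hΦ x).differentiableAt, ?_⟩
    rwa [funext fun x => (hΦ x).deriv]
  obtain ⟨C, hC⟩ := hΦ1.locallyLipschitz.locallyLipschitzOn.exists_lipschitzOnWith_of_compact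
    (isCompact_uIcc.image hv.continuous : IsCompact (v '' uIcc a b))
  have hac : AbsolutelyContinuousOnInterval (Φ ∘ v) a b :=
    (hC.comp hv.lipschitzOnWith (mapsTo_image v _)).absolutelyContinuousOnInterval
  have hsub : Φ (v b) - Φ (v a) = ∫ s in v a..v b, F s :=
    intervalIntegral.integral_interval_sub_left (hF.intervalIntegrable _ _)
      (hF.intervalIntegrable _ _)
  rw [← hsub, ← Function.comp_apply (f := Φ), ← Function.comp_apply (f := Φ) (x := a),
    ← hac.integral_deriv_eq_sub]
  refine intervalIntegral.integral_congr_ae ?_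
  filter_upwards [hv.ae_differentiableAt_real] with t ht _
  exact ((hΦ _).comp t ht.hasDerivAt).deriv.symm

theorem sqrt_one_sub_sq_add_le {p w : ℝ} (hp : p ^ 2 ≤ 1) (hw : 0 ≤ w) :
    √(w ^ 2 + 2 * w) * |p| ≤ 1 - √(1 - p ^ 2) + w := by
  have hx := Real.sq_sqrt (show 0 ≤ 1 - p ^ 2 by linarith)
  have hy := Real.sq_sqrt (show 0 ≤ w ^ 2 + 2 * w by positivity)
  have hsq : (√(1 - p ^ 2) + √(w ^ 2 + 2 * w) * |p|) ^ 2 ≤ (1 + w) ^ 2 := by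
    nlinarith [sq_nonneg (|p| - √(1 - p ^ 2) * √(w ^ 2 + 2 * w)), sq_abs p]
  linarith [(le_abs_self _).trans (abs_le_of_sq_le_sq hsq (by positivity))]

/-- Equality case of `sqrt_one_sub_sq_add_le`. -/
theorem sqrt_one_sub_sq_add_eq {w : ℝ} (hw : 0 ≤ w) :
    1 - √(1 - (√(w ^ 2 + 2 * w) / (1 + w)) ^ 2) + w =
      √(w ^ 2 + 2 * w) * (√(w ^ 2 + 2 * w) / (1 + w)) := by
  have hy := Real.sq_sqrt (show 0 ≤ w ^ 2 + 2 * w by positivity)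
  have h1 : 1 - (√(w ^ 2 + 2 * w) / (1 + w)) ^ 2 = (1 / (1 + w)) ^ 2 := by
    rw [div_pow, hy]
    field_simp
    ring
  rw [h1, Real.sqrt_sq (by positivity), ← mul_div_assoc, ← sq, hy]
  field_simp
  ring

theorem tendsto_integral_of_memX1 {F v : ℝ → ℝ} (hF : Continuous F) (hv : memX1 v) :
    Tendsto (fun n : ℕ => ∫ s in v (-n)..v n, F s) atTop (𝓝 (∫ s in (-1 : ℝ)..1, F s)) := by
  have hd (x : ℝ) : ContinuousAt (fun y => ∫ s in (0 : ℝ)..y, F s) x :=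
    (hF.integral_hasStrictDerivAt 0 x).hasDerivAt.continuousAt
  have hsub (a b : ℝ) :
      (∫ s in (0 : ℝ)..b, F s) - (∫ s in (0 : ℝ)..a, F s) = ∫ s in a..b, F s :=
    intervalIntegral.integral_interval_sub_left (hF.intervalIntegrable _ _)
      (hF.intervalIntegrable _ _)
  rw [← hsub]
  exact (((hd 1).tendsto.comp (hv.2.1.comp tendsto_natCast_atTop_atTop)).sub
    ((hd (-1)).tendsto.comp (hv.2.2.comp
      (tendsto_neg_atTop_atBot.comp tendsto_natCast_atTop_atTop)))).congr fun n => hsub _ _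

theorem DoubleWell.nonneg {W : ℝ → ℝ} (hW : DoubleWell W) (s : ℝ) : 0 ≤ W s := by
  by_cases h : s = -1
  · rw [h, hW.2.1]
  by_cases h' : s = 1
  · rw [h', hW.2.2.1]
  exact (hW.2.2.2 s h h').le

theorem ofReal_integral_le_J1 {W v : ℝ → ℝ} (hW : DoubleWell W) (hv : memX1 v) :
    ENNReal.ofReal (∫ s in (-1 : ℝ)..1, √(W s ^ 2 + 2 * W s)) ≤ J1 W v := by
  have hWc : Continuous W := hW.1.continuous
  have hF : Continuous fun s => √(W s ^ 2 + 2 * W s) := by fun_prop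
  refine le_of_tendsto
    ((ENNReal.continuous_ofReal.tendsto _).comp (tendsto_integral_of_memX1 hF hv)) ?_
  refine .of_forall fun n => ?_
  have hn : -(n : ℝ) ≤ n := by linarith [n.cast_nonneg (α := ℝ)]
  rw [Function.comp_apply, ← integral_comp_mul_deriv_of_lipschitz hF hv.1,
    intervalIntegral.integral_of_le hn]
  refine (ENNReal.ofReal_le_ofReal (Real.le_norm_self _)).trans ?_
  rw [ofReal_norm]
  refine (enorm_integral_le_lintegral_enorm _).trans
    ((setLIntegral_le_lintegral _ _).trans (lintegral_mono fun t => ?_))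
  rw [← ofReal_norm, norm_mul, Real.norm_of_nonneg (Real.sqrt_nonneg _), Real.norm_eq_abs]
  refine ENNReal.ofReal_le_ofReal (sqrt_one_sub_sq_add_le ?_ (hW.nonneg _))
  have h := norm_deriv_le_of_lipschitz (x₀ := t) hv.1
  rw [sq_le_one_iff_abs_le_one]
  simpa using h

theorem J1_le_ofReal_integral {W u : ℝ → ℝ} (hW : DoubleWell W) (hu : memX1 u)
    (hderiv : ∀ t, deriv u t = √(W (u t) ^ 2 + 2 * W (u t)) / (1 + W (u t))) :
    J1 W u ≤ ENNReal.ofReal (∫ s in (-1 : ℝ)..1, √(W s ^ 2 + 2 * W s)) := by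
  have hWc : Continuous W := hW.1.continuous
  have huc : Continuous u := hu.1.continuous
  have hF : Continuous fun s => √(W s ^ 2 + 2 * W s) := by fun_prop
  have hdc : Continuous (deriv u) := by
    rw [funext hderiv]
    exact (hF.comp huc).div (by fun_prop) fun t => by linarith [hW.nonneg (u t)]
  have hJ : J1 W u =
      ∫⁻ t, ENNReal.ofReal (√(W (u t) ^ 2 + 2 * W (u t)) * deriv u t) := by
    refine lintegral_congr fun t => ?_
    rw [hderiv, sqrt_one_sub_sq_add_eq (hW.nonneg _)]
  have hc : Continuous fun t => √(W (u t) ^ 2 + 2 * W (u t)) * deriv u t := by fun_prop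
  have hcover : AECover volume atTop fun n : ℕ => Ioc (-(n : ℝ)) n :=
    aecover_Ioc (tendsto_neg_atTop_atBot.comp tendsto_natCast_atTop_atTop)
      tendsto_natCast_atTop_atTop
  rw [hJ]
  refine (hcover.lintegral_eq_of_tendsto _ hc.measurable.ennreal_ofReal.aemeasurable ?_).le
  refine ((ENNReal.continuous_ofReal.tendsto _).comp (tendsto_integral_of_memX1 hF hu)).congr
    fun n => ?_
  have hn : -(n : ℝ) ≤ n := by linarith [n.cast_nonneg (α := ℝ)]
  rw [Function.comp_apply, ← integral_comp_mul_deriv_of_lipschitz hF hu.1,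
    intervalIntegral.integral_of_le hn, ofReal_integral_eq_lintegral_ofReal]
  · exact (hc.intervalIntegrable _ _).1
  · refine .of_forall fun t => mul_nonneg (Real.sqrt_nonneg _) ?_
    rw [hderiv]
    exact div_nonneg (Real.sqrt_nonneg _) (by linarith [hW.nonneg (u t)])

/-- If `W` is a double-well potential, `J₁` attains its infimum
over `X₁`. -/
theorem J1_attains_infimum (W : ℝ → ℝ) (hW : DoubleWell W) :
    ∃ u : ℝ → ℝ, memX1 u ∧ J1 W u = ⨅ v : {v : ℝ → ℝ // memX1 v}, J1 W v.1 := by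
  have hWc : Continuous W := hW.1.continuous
  have hpos (s : ℝ) : 0 < 1 + W s := by linarith [hW.nonneg s]
  obtain ⟨u, hu, -, hderiv⟩ := exists_front (g := fun s => √(W s ^ 2 + 2 * W s) / (1 + W s))
    (Continuous.div (by fun_prop) (by fun_prop) fun s => (hpos s).ne')
    (fun s hs => by
      have := hW.2.2.2 s hs.1.ne' hs.2.ne
      positivity)
    (fun s => by
      rw [div_le_one (hpos s)]
      exact Real.sqrt_le_iff.2 ⟨(hpos s).le, by linarith⟩)
    (by simp [hW.2.1]) (by simp [hW.2.2.1])
  refine ⟨u, hu, le_antisymm (le_iInf fun v => ?_) (iInf_le_of_le ⟨u, hu⟩ le_rfl)⟩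
  exact (J1_le_ofReal_integral hW hu hderiv).trans (ofReal_integral_le_J1 hW v.2)
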